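/- Let T' be a tree of order n(T') ≥ 2 and let T be the tree obtained from T' by attaching a path P_3 to a vertex that is a support vertex or a weak leaf of T'. Then γ_t^{oi}(S(T)) = γ_t^{oi}(S(T')) + 4. -/

import Mathlib

open SimpleGraph

universe u

/-- A total outer-independent dominating set: every vertex has a neighbor in `D`,
and the complement of `D` is an independent set. -/
def IsTOIDS {V : Type u} (G : SimpleGraph V) (D : Set V) : Prop :=
  (∀ v : V, ∃ u ∈ D, G.Adj v u) ∧ ∀ u ∉ D, ∀ w ∉ D, ¬ G.Adj u w

/-- The total outer-independent domination number. -/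
noncomputable def toidNumber {V : Type u} (G : SimpleGraph V) : ℕ :=
  sInf {n : ℕ | ∃ D : Set V, IsTOIDS G D ∧ D.ncard = n}

/-- The subdivision graph: each edge is replaced by a new vertex adjacent exactly to
its two endpoints. -/
def subdivision {V : Type u} (G : SimpleGraph V) : SimpleGraph (V ⊕ G.edgeSet) :=
  SimpleGraph.fromRel fun x y =>
    ∃ (v : V) (e : G.edgeSet), x = Sum.inl v ∧ y = Sum.inr e ∧ v ∈ (e : Sym2 V)

/-- A leaf: a vertex with exactly one neighbor. -/
def IsLeafVert {V : Type u} (G : SimpleGraph V) (v : V) : Prop := ∃! u, G.Adj v u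

/-- A support vertex: a vertex adjacent to a leaf. -/
def IsSupportVert {V : Type u} (G : SimpleGraph V) (v : V) : Prop :=
  ∃ u, G.Adj v u ∧ IsLeafVert G u

/-- A strong support vertex: a vertex adjacent to at least two leaves. -/
def IsStrongSupportVert {V : Type u} (G : SimpleGraph V) (v : V) : Prop :=
  ∃ u w, u ≠ w ∧ G.Adj v u ∧ G.Adj v w ∧ IsLeafVert G u ∧ IsLeafVert G w

/-- A strong leaf: a leaf adjacent to a strong support vertex. -/
def IsStrongLeaf {V : Type u} (G : SimpleGraph V) (v : V) : Prop :=
  IsLeafVert G v ∧ ∃ u, G.Adj v u ∧ IsStrongSupportVert G u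

/-- A weak leaf: a leaf that is not a strong leaf. -/
def IsWeakLeaf {V : Type u} (G : SimpleGraph V) (v : V) : Prop :=
  IsLeafVert G v ∧ ¬ IsStrongLeaf G v

/-- A semi-support vertex: neither a leaf nor a support vertex, but adjacent to a
support vertex. -/
def IsSemiSupportVert {V : Type u} (G : SimpleGraph V) (v : V) : Prop :=
  ¬ IsLeafVert G v ∧ ¬ IsSupportVert G v ∧ ∃ u, G.Adj v u ∧ IsSupportVert G u

/-- The number of leaves, with the convention that `P₂` has exactly one leaf. -/
noncomputable def leafCount {V : Type u} (G : SimpleGraph V) : ℕ :=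
  if Nat.card V = 2 then 1 else {v | IsLeafVert G v}.ncard

/-- The number of support vertices, with the convention that `P₂` has exactly one
support vertex. -/
noncomputable def supportCount {V : Type u} (G : SimpleGraph V) : ℕ :=
  if Nat.card V = 2 then 1 else {v | IsSupportVert G v}.ncard

/-- The graph obtained from `G` by attaching a path `P_r` to the vertex `v`:
the new vertices form a path `p₀ p₁ ⋯ p_{r-1}` and `v` is joined to the end `p₀`. -/
def attachPath {V : Type u} (G : SimpleGraph V) (v : V) (r : ℕ) :
    SimpleGraph (V ⊕ Fin r) :=
  SimpleGraph.fromRel fun x y =>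
    (∃ a b, x = Sum.inl a ∧ y = Sum.inl b ∧ G.Adj a b) ∨
    (∃ i j : Fin r, x = Sum.inr i ∧ y = Sum.inr j ∧ (j : ℕ) = (i : ℕ) + 1) ∨
    (∃ i : Fin r, x = Sum.inl v ∧ y = Sum.inr i ∧ (i : ℕ) = 0)

/-- The graph obtained from `G` by adding a disjoint copy of the tree `Q_r`
(`r` paths `P₃` joined to a central vertex) and identifying the central vertex
of `Q_r` with the vertex `v` of `G`. -/
def attachQ {V : Type u} (G : SimpleGraph V) (v : V) (r : ℕ) :
    SimpleGraph (V ⊕ Fin r × Fin 3) :=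
  SimpleGraph.fromRel fun x y =>
    (∃ a b, x = Sum.inl a ∧ y = Sum.inl b ∧ G.Adj a b) ∨
    (∃ i : Fin r, x = Sum.inl v ∧ y = Sum.inr (i, 0)) ∨
    (∃ (i : Fin r) (j k : Fin 3),
      x = Sum.inr (i, j) ∧ y = Sum.inr (i, k) ∧ (k : ℕ) = (j : ℕ) + 1)

/-- The family `F`: all trees obtainable from `P₂` by repeatedly
(F1) attaching `P₁` to a support vertex, (F2) attaching `P₂` to a support or
semi-support vertex, (F3) attaching `P₃` to a weak leaf. -/
inductive InFamilyF : {W : Type u} → SimpleGraph W → Prop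
  | base {W : Type u} (G : SimpleGraph W) (e : G ≃g SimpleGraph.pathGraph 2) :
      InFamilyF G
  | op1 {W : Type u} {G' : SimpleGraph W} {v : W} (hv : IsSupportVert G' v)
      (hF : InFamilyF G') {U : Type u} (G : SimpleGraph U)
      (e : G ≃g attachPath G' v 1) : InFamilyF G
  | op2 {W : Type u} {G' : SimpleGraph W} {v : W}
      (hv : IsSupportVert G' v ∨ IsSemiSupportVert G' v)
      (hF : InFamilyF G') {U : Type u} (G : SimpleGraph U)
      (e : G ≃g attachPath G' v 2) : InFamilyF G
  | op3 {W : Type u} {G' : SimpleGraph W} {v : W} (hv : IsWeakLeaf G' v)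
      (hF : InFamilyF G') {U : Type u} (G : SimpleGraph U)
      (e : G ≃g attachPath G' v 3) : InFamilyF G

/-- The family `𝒯`: all trees obtainable from `P₂` by repeatedly
(O1) attaching `P₁` to a support vertex, (O2) attaching `P₃` to a support vertex or a
weak leaf, (O3) adding a copy of `Q_r` (`r ≥ 2`) identifying its central vertex with a
weak leaf. -/
inductive InFamilyT : {W : Type u} → SimpleGraph W → Prop
  | base {W : Type u} (G : SimpleGraph W) (e : G ≃g SimpleGraph.pathGraph 2) :
      InFamilyT G
  | op1 {W : Type u} {G' : SimpleGraph W} {v : W} (hv : IsSupportVert G' v)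
      (hF : InFamilyT G') {U : Type u} (G : SimpleGraph U)
      (e : G ≃g attachPath G' v 1) : InFamilyT G
  | op2 {W : Type u} {G' : SimpleGraph W} {v : W}
      (hv : IsSupportVert G' v ∨ IsWeakLeaf G' v)
      (hF : InFamilyT G') {U : Type u} (G : SimpleGraph U)
      (e : G ≃g attachPath G' v 3) : InFamilyT G
  | op3 {W : Type u} {G' : SimpleGraph W} {v : W} (hv : IsWeakLeaf G' v)
      (hF : InFamilyT G') {r : ℕ} (hr : 2 ≤ r) {U : Type u} (G : SimpleGraph U)
      (e : G ≃g attachQ G' v r) : InFamilyT G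

theorem IsTOIDS.image {V W : Type u} {G : SimpleGraph V} {H : SimpleGraph W} (e : G ≃g H)
    {D : Set V} (hD : IsTOIDS G D) : IsTOIDS H (e '' D) := by
  refine ⟨fun w => ?_, fun a ha b hb hab => ?_⟩
  · obtain ⟨u, hu, hadj⟩ := hD.1 (e.symm w)
    exact ⟨e u, ⟨u, hu, rfl⟩, by simpa using e.map_adj_iff.2 hadj⟩
  · refine hD.2 (e.symm a) (fun h => ha ⟨_, h, by simp⟩) (e.symm b) (fun h => hb ⟨_, h, by simp⟩) ?_
    exact e.symm.map_adj_iff.2 hab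

theorem toidNumber_congr {V W : Type u} {G : SimpleGraph V} {H : SimpleGraph W} (e : G ≃g H) :
    toidNumber G = toidNumber H := by
  unfold toidNumber
  congr 1
  ext n
  constructor
  · rintro ⟨D, hD, rfl⟩
    exact ⟨e '' D, hD.image e, Set.ncard_image_of_injective D e.injective⟩
  · rintro ⟨D, hD, rfl⟩
    exact ⟨e.symm '' D, hD.image e.symm, Set.ncard_image_of_injective D e.symm.injective⟩

theorem IsTOIDS.toidNumber_le {V : Type u} {G : SimpleGraph V} {D : Set V} (hD : IsTOIDS G D) :
    toidNumber G ≤ D.ncard :=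
  Nat.sInf_le ⟨D, hD, rfl⟩

theorem IsTOIDS.exists_minimum {V : Type u} {G : SimpleGraph V} {D : Set V} (hD : IsTOIDS G D) :
    ∃ D' : Set V, IsTOIDS G D' ∧ D'.ncard = toidNumber G :=
  Nat.sInf_mem (s := {n : ℕ | ∃ D : Set V, IsTOIDS G D ∧ D.ncard = n}) ⟨_, D, hD, rfl⟩

section AttachPath

variable {V : Type u} {G : SimpleGraph V} {v : V} {r : ℕ}

@[simp]
theorem attachPath_adj_inl_inl {a b : V} :
    (attachPath G v r).Adj (Sum.inl a) (Sum.inl b) ↔ G.Adj a b := by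
  simp only [attachPath, fromRel_adj]
  constructor
  · rintro ⟨_, h | h⟩ <;> simp at h
    exacts [h, h.symm]
  · intro h
    simp [h, h.ne]

@[simp]
theorem attachPath_adj_inl_inr {a : V} {i : Fin r} :
    (attachPath G v r).Adj (Sum.inl a) (Sum.inr i) ↔ a = v ∧ (i : ℕ) = 0 := by
  simp [attachPath]

@[simp]
theorem attachPath_adj_inr_inl {a : V} {i : Fin r} :
    (attachPath G v r).Adj (Sum.inr i) (Sum.inl a) ↔ a = v ∧ (i : ℕ) = 0 := by
  rw [adj_comm, attachPath_adj_inl_inr]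

@[simp]
theorem attachPath_adj_inr_inr {i j : Fin r} :
    (attachPath G v r).Adj (Sum.inr i) (Sum.inr j) ↔ (j : ℕ) = i + 1 ∨ (i : ℕ) = j + 1 := by
  simp only [attachPath, fromRel_adj]
  simp only [reduceCtorEq, false_and, exists_false, false_or, or_false, Sum.inr.injEq, ne_eq,
    exists_eq_left', exists_and_left, and_false]
  rw [Fin.ext_iff]
  omega

end AttachPath

section Subdivision

variable {V : Type u} {G : SimpleGraph V}

@[simp]
theorem subdivision_adj_inl_inl {a b : V} :
    ¬ (subdivision G).Adj (Sum.inl a) (Sum.inl b) := by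
  simp [subdivision]

@[simp]
theorem subdivision_adj_inr_inr {e f : G.edgeSet} :
    ¬ (subdivision G).Adj (Sum.inr e) (Sum.inr f) := by
  simp [subdivision]

@[simp]
theorem subdivision_adj_inl_inr {a : V} {e : G.edgeSet} :
    (subdivision G).Adj (Sum.inl a) (Sum.inr e) ↔ a ∈ (e : Sym2 V) := by
  simp [subdivision]

@[simp]
theorem subdivision_adj_inr_inl {a : V} {e : G.edgeSet} :
    (subdivision G).Adj (Sum.inr e) (Sum.inl a) ↔ a ∈ (e : Sym2 V) := by
  simp [subdivision]

/-- If no vertex of `G` is isolated, the full vertex set is a total outer-independent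
dominating set of the subdivision graph. -/
theorem isTOIDS_subdivision_univ (hG : ∀ a, ∃ b, G.Adj a b) :
    IsTOIDS (subdivision G) Set.univ := by
  refine ⟨?_, fun u hu => absurd (Set.mem_univ u) hu⟩
  rintro (a | ⟨e, he⟩)
  · obtain ⟨b, hab⟩ := hG a
    exact ⟨Sum.inr ⟨s(a, b), hab⟩, trivial, by simp⟩
  · induction e with
    | _ a b => exact ⟨Sum.inl a, trivial, by simp⟩

theorem IsLeafVert.subdivision_inl {a : V} (ha : IsLeafVert G a) :
    IsLeafVert (subdivision G) (Sum.inl a) := by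
  obtain ⟨b, hab, hb⟩ := ha
  refine ⟨Sum.inr ⟨s(a, b), hab⟩, by simp, ?_⟩
  rintro (c | ⟨e, he⟩) hc
  · simp at hc
  · obtain ⟨c, rfl⟩ : a ∈ e := by simpa using hc
    simp [hb c he]

end Subdivision

section SubdivisionAttachPath

variable {V : Type u} (G : SimpleGraph V) (v : V) (r : ℕ)

/-- The vertex of `attachPath G v r` preceding the `j`-th vertex of the attached path. -/
def attachPathPred (j : Fin r) : V ⊕ Fin r :=
  if (j : ℕ) = 0 then Sum.inl v else Sum.inr ⟨j - 1, by omega⟩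

theorem attachPath_adj_pred (j : Fin r) :
    (attachPath G v r).Adj (attachPathPred v r j) (Sum.inr j) := by
  unfold attachPathPred
  split_ifs with h
  · simp [h]
  · simp
    omega

variable {v r} in
theorem inl_mem_attachPathEdge {a : V} {j : Fin r} :
    Sum.inl a ∈ s(attachPathPred v r j, Sum.inr j) ↔ a = v ∧ (j : ℕ) = 0 := by
  unfold attachPathPred
  split_ifs with h <;> simp [h]

variable {v r} in
theorem inr_mem_attachPathEdge {i j : Fin r} :
    Sum.inr i ∈ s(attachPathPred v r j, Sum.inr j) ↔ i = j ∨ (j : ℕ) = i + 1 := by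
  unfold attachPathPred
  split_ifs with h <;> simp [h, Fin.ext_iff]
  omega

/-- The map identifying the subdivision of `attachPath G v r` with the subdivision of `G` to
which a path on `2 * r` vertices is attached at `v`. -/
def attachPathSubdivisionMap :
    (V ⊕ G.edgeSet) ⊕ Fin (2 * r) → (V ⊕ Fin r) ⊕ (attachPath G v r).edgeSet
  | Sum.inl (Sum.inl a) => Sum.inl (Sum.inl a)
  | Sum.inl (Sum.inr e) => Sum.inr ⟨(e : Sym2 V).map Sum.inl, by
      obtain ⟨e, he⟩ := e
      induction e with
      | _ a b => simpa using he⟩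
  | Sum.inr i =>
    if (i : ℕ) % 2 = 0 then
      Sum.inr ⟨s(attachPathPred v r ⟨i / 2, by omega⟩, Sum.inr ⟨i / 2, by omega⟩),
        attachPath_adj_pred G v r _⟩
    else Sum.inl (Sum.inr ⟨i / 2, by omega⟩)

theorem attachPathSubdivisionMap_bijective :
    Function.Bijective (attachPathSubdivisionMap G v r) := by
  have hpred : ∀ {i j : Fin r}, s(attachPathPred v r i, Sum.inr i) =
      s(attachPathPred v r j, Sum.inr j) → i = j := by
    intro i j h
    have h1 : Sum.inr i ∈ s(attachPathPred v r j, Sum.inr j) := h ▸ Sym2.mem_mk_right _ _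
    have h2 : Sum.inr j ∈ s(attachPathPred v r i, Sum.inr i) := h ▸ Sym2.mem_mk_right _ _
    rw [inr_mem_attachPathEdge] at h1 h2
    omega
  have hmap : ∀ (e : Sym2 V) (j : Fin r),
      e.map Sum.inl ≠ s(attachPathPred v r j, Sum.inr j) := by
    intro e j h
    have : Sum.inr j ∈ e.map (Sum.inl : V → V ⊕ Fin r) := h ▸ Sym2.mem_mk_right _ _
    simp [Sym2.mem_map] at this
  constructor
  · rintro ((a | e) | i) ((b | f) | j) h
    · simpa [attachPathSubdivisionMap] using h
    · simp [attachPathSubdivisionMap] at h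
    · simp only [attachPathSubdivisionMap] at h
      split_ifs at h
      simp at h
    · simp [attachPathSubdivisionMap] at h
    · simp only [attachPathSubdivisionMap, Sum.inr.injEq, Subtype.mk.injEq] at h
      rw [Subtype.ext (Sym2.map.injective Sum.inl_injective h)]
    · simp only [attachPathSubdivisionMap] at h
      split_ifs at h
      exact absurd (congrArg Subtype.val (Sum.inr_injective h)) (hmap _ _)
    · simp only [attachPathSubdivisionMap] at h
      split_ifs at h
      simp at h
    · simp only [attachPathSubdivisionMap] at h
      split_ifs at h
      exact absurd (congrArg Subtype.val (Sum.inr_injective h)).symm (hmap _ _)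
    · simp only [attachPathSubdivisionMap] at h
      congr 1
      ext
      split_ifs at h
      · have := congrArg Fin.val (hpred (congrArg Subtype.val (Sum.inr_injective h)))
        simp at this
        omega
      · simp at h
        omega
  · have hedge : ∀ j : Fin r, ∃ x, attachPathSubdivisionMap G v r x =
        Sum.inr ⟨s(attachPathPred v r j, Sum.inr j), attachPath_adj_pred G v r _⟩ := fun j =>
      ⟨Sum.inr ⟨2 * j, by omega⟩, by simp [attachPathSubdivisionMap]⟩
    rintro ((a | i) | ⟨e, he⟩)
    · exact ⟨Sum.inl (Sum.inl a), rfl⟩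
    · refine ⟨Sum.inr ⟨2 * i + 1, by omega⟩, ?_⟩
      have h1 : (2 * (i : ℕ) + 1) % 2 ≠ 0 := by omega
      have h2 : (2 * (i : ℕ) + 1) / 2 = i := by omega
      simp [attachPathSubdivisionMap, h2]
    · induction e with
      | _ x y =>
        rcases x with a | i <;> rcases y with b | j
        · exact ⟨Sum.inl (Sum.inr ⟨s(a, b), by simpa using he⟩), rfl⟩
        · obtain ⟨x, hx⟩ := hedge j
          refine ⟨x, hx.trans ?_⟩
          have := attachPath_adj_inl_inr.1 he
          simp [attachPathPred, this]
        · obtain ⟨x, hx⟩ := hedge i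
          refine ⟨x, hx.trans ?_⟩
          have := attachPath_adj_inr_inl.1 he
          simp [attachPathPred, this, Sym2.eq_swap]
        · rcases attachPath_adj_inr_inr.1 he with h | h
          · obtain ⟨x, hx⟩ := hedge j
            refine ⟨x, hx.trans ?_⟩
            simp [attachPathPred, h]
          · obtain ⟨x, hx⟩ := hedge i
            refine ⟨x, hx.trans ?_⟩
            simp [attachPathPred, h, Sym2.eq_swap]

/-- Subdividing after attaching a path on `r` vertices amounts to attaching a path on `2 * r`
vertices to the subdivision. -/
noncomputable def attachPathSubdivisionIso :
    attachPath (subdivision G) (Sum.inl v) (2 * r) ≃g subdivision (attachPath G v r) where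
  toEquiv := Equiv.ofBijective _ (attachPathSubdivisionMap_bijective G v r)
  map_rel_iff' := by
    have hmem : ∀ (a : V) (e : Sym2 V),
        (Sum.inl a : V ⊕ Fin r) ∈ e.map Sum.inl ↔ a ∈ e := by
      simp [Sym2.mem_map]
    have hnot : ∀ (i : Fin r) (e : Sym2 V), (Sum.inr i : V ⊕ Fin r) ∉ e.map Sum.inl := by
      simp [Sym2.mem_map]
    rintro ((a | e) | i) ((b | f) | j) <;>
      simp only [Equiv.ofBijective_apply, attachPathSubdivisionMap] <;>
      (try split_ifs) <;>
      simp [hmem, hnot, inl_mem_attachPathEdge, inr_mem_attachPathEdge, -Sym2.mem_iff,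
        -Sym2.mem_map] <;>
      omega

end SubdivisionAttachPath


section AttachPathSix

variable {V : Type u} {G : SimpleGraph V} {v : V}

theorem ncard_preimage_inl_add_ncard_preimage_inr {α β : Type*} [Finite α] [Finite β]
    (D : Set (α ⊕ β)) : (Sum.inl ⁻¹' D).ncard + (Sum.inr ⁻¹' D).ncard = D.ncard := by
  conv_rhs => rw [← Set.image_preimage_inl_union_image_preimage_inr D]
  rw [Set.ncard_union_eq, Set.ncard_image_of_injective _ Sum.inl_injective,
    Set.ncard_image_of_injective _ Sum.inr_injective]
  rw [Set.disjoint_left]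
  rintro _ ⟨a, _, rfl⟩ ⟨b, _, h⟩
  cases h

theorem IsTOIDS.attachPath_six {D : Set V} (hD : IsTOIDS G D) :
    IsTOIDS (attachPath G v 6) (Sum.inl '' D ∪ Sum.inr '' {0, 1, 3, 4}) := by
  refine ⟨?_, ?_⟩
  · rintro (a | i)
    · obtain ⟨b, hb, hab⟩ := hD.1 a
      exact ⟨Sum.inl b, by simpa using hb, by simpa using hab⟩
    · have : ∃ j : Fin 6, (j = 0 ∨ j = 1 ∨ j = 3 ∨ j = 4) ∧
          ((j : ℕ) = i + 1 ∨ (i : ℕ) = j + 1) := by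
        revert i
        decide
      obtain ⟨j, hj, hij⟩ := this
      exact ⟨Sum.inr j, by simpa using hj, by simpa using hij⟩
  · rintro (a | i) ha (b | j) hb hab
    · simp at ha hb hab
      exact hD.2 a ha b hb hab
    · simp at hb hab
      omega
    · simp at ha hab
      omega
    · simp at ha hb hab
      omega

theorem IsTOIDS.four_le_ncard_preimage_inr {D : Set (V ⊕ Fin 6)}
    (hD : IsTOIDS (attachPath G v 6) D) : 4 ≤ (Sum.inr ⁻¹' D : Set (Fin 6)).ncard := by
  classical
  have hcover : ∀ i j : Fin 6, (j : ℕ) = i + 1 → Sum.inr i ∈ D ∨ Sum.inr j ∈ D := by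
    intro i j hij
    by_contra! h
    exact hD.2 _ h.1 _ h.2 (by simp [hij])
  have hdom : ∀ i : Fin 6, (i : ℕ) ≠ 0 →
      ∃ j : Fin 6, Sum.inr j ∈ D ∧ ((j : ℕ) = i + 1 ∨ (i : ℕ) = j + 1) := by
    intro i hi
    obtain ⟨b | j, hj, hij⟩ := hD.1 (Sum.inr i)
    · simp [hi] at hij
    · exact ⟨j, hj, by simpa using hij⟩
  have key : ∀ s : Finset (Fin 6),
      (∀ i j : Fin 6, (j : ℕ) = i + 1 → i ∈ s ∨ j ∈ s) →
      (∀ i : Fin 6, (i : ℕ) ≠ 0 → ∃ j : Fin 6, j ∈ s ∧ ((j : ℕ) = i + 1 ∨ (i : ℕ) = j + 1)) →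
      4 ≤ s.card := by
    decide
  rw [Set.ncard_eq_toFinset_card']
  exact key _ (by simpa using hcover) (fun i hi => by simpa using hdom i hi)

theorem IsTOIDS.exists_of_attachPath {r : ℕ} [Finite V]
    (hv : (∃ f l, l ≠ v ∧ G.Adj v f ∧ G.Adj f l ∧ IsLeafVert G l) ∨
      IsLeafVert G v ∧ ∃ f w, w ≠ v ∧ G.Adj v f ∧ G.Adj f w)
    {D : Set (V ⊕ Fin r)} (hD : IsTOIDS (attachPath G v r) D) :
    ∃ A : Set V, IsTOIDS G A ∧ A.ncard ≤ (Sum.inl ⁻¹' D : Set V).ncard := by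
  set A : Set V := Sum.inl ⁻¹' D with hA
  have hind : ∀ a ∉ A, ∀ b ∉ A, ¬ G.Adj a b := fun a ha b hb hab =>
    hD.2 (Sum.inl a) ha (Sum.inl b) hb (by simpa using hab)
  have hdom : ∀ a, a ≠ v → ∃ b ∈ A, G.Adj a b := by
    intro a ha
    obtain ⟨b | j, hb, hab⟩ := hD.1 (Sum.inl a)
    · exact ⟨b, hb, by simpa using hab⟩
    · simp [ha] at hab
  by_cases hvA : ∃ b ∈ A, G.Adj v b
  · refine ⟨A, ⟨fun a => ?_, hind⟩, le_rfl⟩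
    obtain rfl | ha := eq_or_ne a v
    exacts [hvA, hdom a ha]
  · push Not at hvA
    rcases hv with ⟨f, l, hl, hvf, hfl, hleaf⟩ | ⟨hleaf, f, w, hw, hvf, hfw⟩
    · obtain ⟨b, hb, hlb⟩ := hdom l hl
      rw [hleaf.unique hlb hfl.symm] at hb
      exact absurd hvf (hvA f hb)
    · have hf : f ∉ A := fun h => hvA f h hvf
      have hvmem : v ∈ A := by
        by_contra h
        exact hind v h f hf hvf
      have hwmem : w ∈ A := by
        by_contra h
        exact hind f hf w h hfw
      refine ⟨insert f (A \ {v}), ⟨fun a => ?_, fun a ha b hb hab => ?_⟩, ?_⟩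
      · obtain rfl | ha := eq_or_ne a v
        · exact ⟨f, by simp, hvf⟩
        · obtain ⟨b, hb, hab⟩ := hdom a ha
          obtain rfl | hbv := eq_or_ne b v
          · rw [hleaf.unique hab.symm hvf]
            exact ⟨w, by simp [hwmem, hw], hfw⟩
          · exact ⟨b, by simp [hb, hbv], hab⟩
      · simp only [Set.mem_insert_iff, Set.mem_sdiff, Set.mem_singleton_iff, not_or, not_and,
          not_not] at ha hb
        obtain rfl | hav := eq_or_ne a v
        · exact hb.1 (hleaf.unique hab hvf)
        obtain rfl | hbv := eq_or_ne b v
        · exact ha.1 (hleaf.unique hab.symm hvf)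
        exact hind a (fun h => hav (ha.2 h)) b (fun h => hbv (hb.2 h)) hab
      · rw [Set.ncard_exchange hf hvmem]

theorem toidNumber_attachPath_six [Finite V]
    (hG : ∃ D, IsTOIDS G D)
    (hv : (∃ f l, l ≠ v ∧ G.Adj v f ∧ G.Adj f l ∧ IsLeafVert G l) ∨
      IsLeafVert G v ∧ ∃ f w, w ≠ v ∧ G.Adj v f ∧ G.Adj f w) :
    toidNumber (attachPath G v 6) = toidNumber G + 4 := by
  obtain ⟨D₀, hD₀⟩ := hG
  obtain ⟨D', hD', hcard'⟩ := hD₀.exists_minimum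
  apply le_antisymm
  · refine hD'.attachPath_six.toidNumber_le.trans ((Set.ncard_union_le _ _).trans ?_)
    rw [Set.ncard_image_of_injective _ Sum.inl_injective,
      Set.ncard_image_of_injective _ Sum.inr_injective, hcard', Set.ncard_eq_toFinset_card']
    rfl
  · obtain ⟨D, hD, hcard⟩ := (hD'.attachPath_six (v := v)).exists_minimum
    obtain ⟨A, hA, hAcard⟩ := hD.exists_of_attachPath hv
    have h4 := hD.four_le_ncard_preimage_inr
    have hsum := ncard_preimage_inl_add_ncard_preimage_inr D
    have := hA.toidNumber_le
    omega

end AttachPathSix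

theorem attach_P3_to_support_or_weak_leaf {V : Type u} [Fintype V]
    (T' : SimpleGraph V) (hT' : T'.IsTree) (hn : 2 ≤ Nat.card V) (v : V)
    (hv : IsSupportVert T' v ∨ IsWeakLeaf T' v) :
    toidNumber (subdivision (attachPath T' v 3)) = toidNumber (subdivision T') + 4 := by
  have : Nontrivial V := Finite.one_lt_card_iff_nontrivial.1 hn
  rw [← toidNumber_congr (attachPathSubdivisionIso T' v 3)]
  refine toidNumber_attachPath_six
    ⟨_, isTOIDS_subdivision_univ hT'.connected.preconnected.exists_adj_of_nontrivial⟩ ?_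
  rcases hv with ⟨l, hvl, hl⟩ | ⟨hleaf, -⟩
  · exact Or.inl ⟨Sum.inr ⟨s(v, l), hvl⟩, Sum.inl l, by simpa using hvl.ne', by simp, by simp,
      hl.subdivision_inl⟩
  · obtain ⟨w, hvw, -⟩ := id hleaf
    exact Or.inr ⟨hleaf.subdivision_inl, Sum.inr ⟨s(v, w), hvw⟩, Sum.inl w,
      by simpa using hvw.ne', by simp, by simp⟩
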